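/- Suppose p ∈ (0,1] and q ∈ [0,1) satisfy max{p, 1−q} ≥ θ/n for a constant θ > 0. Consider a random matching algorithm on an edge-Markovian evolving graph with parameters p, q whose matching distributions satisfy the F-fair condition for a constant F (i.e., F = Ω(1), 0 < F ≤ 1). Then there exists a constant C > 0 such that for any initial configuration Γ_0, with probability at least 1 − 1/n the balancing time satisfies T_bal ≤ C·r·log(Δ·n), where r = max{p/(1−q), (1−q)/p}. -/

import Mathlib

open Finset

noncomputable section

/-- Rounding a real number to the nearest integer, ties rounded up: `⌈x⌋ := ⌈x - 1/2⌉`. -/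
def roundNear (x : ℝ) : ℤ := ⌈x - 1 / 2⌉

/-- The degree of a vertex in a simple graph (stated without decidability assumptions). -/
def gdeg {V : Type} (G : SimpleGraph V) (v : V) : ℕ := Nat.card {u : V // G.Adj v u}

/-- The initial discrepancy `Δ = max Γ₀ - min Γ₀` of a load configuration. -/
def disc {V : Type} [Fintype V] [Nonempty V] (Γ₀ : V → ℕ) : ℕ :=
  Finset.univ.sup Γ₀ - Finset.univ.inf' Finset.univ_nonempty Γ₀

/-- An execution of a random matching load-balancing algorithm on an edge-Markovian
evolving graph with parameters `p, q` on the vertex set `V`: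
* `G t` is the (random) graph at time `t`, `M t` the random matching chosen at time `t`,
  and `Γ t` the load configuration at time `t`;
* `hist t` is the σ-algebra of events determined by the history
  `Γ_0, G_0, M_0, Γ_1, …, G_{t-1}, M_{t-1}, Γ_t` of the execution up to time `t`;
* conditionally on any (positive-probability) event determined by the history up to time `t+1`
  which determines `G t = H`, every non-edge of `H` becomes an edge of `G (t+1)` with
  probability `p`, every edge of `H` disappears with probability `q`, independently over pairs;
* for every matched pair `{v,u}` of `M t`, the loads are rebalanced to
  `(⌈(Γ t v + Γ t u)/2⌉, ⌊(Γ t v + Γ t u)/2⌋)` or the transposed pair (each with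
  probability `1/2`, which only matters when `Γ t v + Γ t u` is odd), while
  unmatched vertices keep their loads. -/
structure EMLoadProcess (V : Type) [Fintype V] [DecidableEq V] where
  Ω : Type
  [mΩ : MeasurableSpace Ω]
  μ : MeasureTheory.Measure Ω
  isProb : MeasureTheory.IsProbabilityMeasure μ
  p : ℝ
  q : ℝ
  p_pos : 0 < p
  p_le_one : p ≤ 1
  q_nonneg : 0 ≤ q
  q_lt_one : q < 1
  G : ℕ → Ω → SimpleGraph V
  M : ℕ → Ω → Set (Sym2 V)
  Γ : ℕ → Ω → V → ℕ
  hist : ℕ → MeasurableSpace Ω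
  hist_le : ∀ t, hist t ≤ mΩ
  hist_mono : Monotone hist
  meas_Γ : ∀ t, @Measurable Ω (V → ℕ) (hist t) ⊤ (Γ t)
  meas_G : ∀ t, @Measurable Ω (SimpleGraph V) (hist (t + 1)) ⊤ (G t)
  meas_M : ∀ t, @Measurable Ω (Set (Sym2 V)) (hist (t + 1)) ⊤ (M t)
  M_sub : ∀ t ω, M t ω ⊆ (G t ω).edgeSet
  M_matching : ∀ t ω, ∀ e ∈ M t ω, ∀ f ∈ M t ω, ∀ x : V, x ∈ e → x ∈ f → e = f
  unmatched : ∀ t ω v, (∀ u : V, s(v, u) ∉ M t ω) → Γ (t + 1) ω v = Γ t ω v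
  matched : ∀ t ω v u, s(v, u) ∈ M t ω →
    (Γ (t + 1) ω v = (Γ t ω v + Γ t ω u + 1) / 2 ∧ Γ (t + 1) ω u = (Γ t ω v + Γ t ω u) / 2) ∨
    (Γ (t + 1) ω v = (Γ t ω v + Γ t ω u) / 2 ∧ Γ (t + 1) ω u = (Γ t ω v + Γ t ω u + 1) / 2)
  coin : ∀ (t : ℕ) (v u : V) (E : Set Ω),
    @MeasurableSet _ (hist t ⊔ MeasurableSpace.comap (G t) ⊤ ⊔ MeasurableSpace.comap (M t) ⊤) E →
    μ E ≠ 0 → E ⊆ {ω | s(v, u) ∈ M t ω ∧ Odd (Γ t ω v + Γ t ω u)} →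
    ProbabilityTheory.cond μ E {ω | Γ (t + 1) ω v = (Γ t ω v + Γ t ω u + 1) / 2} = 1 / 2
  markov_edge : ∀ (t : ℕ) (H : SimpleGraph V) (E : Set Ω), @MeasurableSet _ (hist (t + 1)) E →
    μ E ≠ 0 → E ⊆ {ω | G t ω = H} → ∀ e : Sym2 V, ¬e.IsDiag → e ∈ H.edgeSet →
    ProbabilityTheory.cond μ E {ω | e ∈ (G (t + 1) ω).edgeSet} = ENNReal.ofReal (1 - q)
  markov_nonedge : ∀ (t : ℕ) (H : SimpleGraph V) (E : Set Ω), @MeasurableSet _ (hist (t + 1)) E →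
    μ E ≠ 0 → E ⊆ {ω | G t ω = H} → ∀ e : Sym2 V, ¬e.IsDiag → e ∉ H.edgeSet →
    ProbabilityTheory.cond μ E {ω | e ∈ (G (t + 1) ω).edgeSet} = ENNReal.ofReal p
  markov_indep : ∀ (t : ℕ) (H : SimpleGraph V) (E : Set Ω), @MeasurableSet _ (hist (t + 1)) E →
    μ E ≠ 0 → E ⊆ {ω | G t ω = H} →
    ProbabilityTheory.iIndepSet (fun e : {e : Sym2 V // ¬e.IsDiag} => {ω | (e : Sym2 V) ∈ (G (t + 1) ω).edgeSet})
      (ProbabilityTheory.cond μ E)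

/-- The `F`-fair condition: conditionally on `G t = Gr` and any (positive-probability) event
determined by the history of the execution up to time `t`, every edge `{u,v}` of `Gr` is matched
with probability at least `F / max (deg u) (deg v)`. -/
def EMLoadProcess.Fair {V : Type} [Fintype V] [DecidableEq V]
    (P : EMLoadProcess V) (F : ℝ) : Prop :=
  ∀ (t : ℕ) (Gr : SimpleGraph V) (u v : V), Gr.Adj u v →
    ∀ E : Set P.Ω, @MeasurableSet _ (P.hist t) E →
      P.μ ({ω | P.G t ω = Gr} ∩ E) ≠ 0 →
      ENNReal.ofReal (F / (max (gdeg Gr u) (gdeg Gr v) : ℝ)) ≤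
        ProbabilityTheory.cond P.μ ({ω | P.G t ω = Gr} ∩ E) {ω | s(u, v) ∈ P.M t ω}

/-- The ratio `r := max{p/(1−q), (1−q)/p}` of an edge-Markovian evolving graph. -/
def EMLoadProcess.r {V : Type} [Fintype V] [DecidableEq V] (P : EMLoadProcess V) : ℝ :=
  max (P.p / (1 - P.q)) ((1 - P.q) / P.p)

/-- The average load `μ = (Σ_v Γ₀(v))/n` of a configuration `Γ₀`. -/
def avgLoad {V : Type} [Fintype V] (Γ₀ : V → ℕ) : ℝ :=
  (∑ v : V, (Γ₀ v : ℝ)) / (Fintype.card V : ℝ)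

/-- The convex potential `k² - |k|` of a load at distance `k` from the target; it vanishes exactly
on `{-1, 0, 1}`. -/
def pot (k : ℤ) : ℤ := k ^ 2 - |k|

lemma pot_nonneg (k : ℤ) : 0 ≤ pot k := by
  unfold pot
  rcases abs_cases k with ⟨h, h'⟩ | ⟨h, h'⟩ <;> rw [h]
  · rcases h'.eq_or_lt with h0 | h0 <;> nlinarith
  · nlinarith

lemma abs_le_one_of_pot_lt_one {k : ℤ} (h : pot k < 1) : |k| ≤ 1 := by
  unfold pot at h
  by_contra! hk
  rw [← sq_abs] at h
  nlinarith

/-- The decrease of the potential when two loads `x` and `y` are balanced. -/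
def gain (x y : ℤ) : ℤ := pot x + pot y - pot ((x + y + 1) / 2) - pot ((x + y) / 2)

lemma gain_neg (x y : ℤ) : gain (-x) (-y) = gain x y := by
  have h1 : (-x + -y + 1) / 2 = -((x + y) / 2) := by omega
  have h2 : (-x + -y) / 2 = -((x + y + 1) / 2) := by omega
  unfold gain
  rw [h1, h2]
  simp only [pot, abs_neg, neg_sq]
  ring

lemma gain_self (x : ℤ) : gain x x = 0 := by
  have h1 : (x + x + 1) / 2 = x := by omega
  have h2 : (x + x) / 2 = x := by omega
  unfold gain
  rw [h1, h2]
  ring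

lemma gain_of_even (c d : ℤ) : gain (c + d) (c - d) = 2 * d ^ 2 + 2 * |c| - |c + d| - |c - d| := by
  have h1 : (c + d + (c - d) + 1) / 2 = c := by omega
  have h2 : (c + d + (c - d)) / 2 = c := by omega
  unfold gain pot
  rw [h1, h2]
  ring

lemma gain_of_odd (c d : ℤ) : gain (c + 1 + d) (c - d) =
    2 * d * (d + 1) + |c + 1| + |c| - |c + 1 + d| - |c - d| := by
  have h1 : (c + 1 + d + (c - d) + 1) / 2 = c + 1 := by omega
  have h2 : (c + 1 + d + (c - d)) / 2 = c := by omega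
  unfold gain pot
  rw [h1, h2]
  ring

lemma even_or_odd_split (x y : ℤ) :
    (∃ c d, x = c + d ∧ y = c - d) ∨ ∃ c d, x = c + 1 + d ∧ y = c - d := by
  obtain ⟨c, hc | hc⟩ := Int.even_or_odd' (x + y)
  · exact Or.inl ⟨c, x - c, by omega, by omega⟩
  · exact Or.inr ⟨c, x - c - 1, by omega, by omega⟩

lemma gain_nonneg (x y : ℤ) : 0 ≤ gain x y := by
  obtain ⟨c, d, rfl, rfl⟩ | ⟨c, d, rfl, rfl⟩ := even_or_odd_split x y
  · rw [gain_of_even]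
    have h1 := abs_add_le c d
    have h2 := abs_sub c d
    have h3 := pot_nonneg d
    unfold pot at h3
    linarith
  · rw [gain_of_odd]
    rcases le_or_gt 0 d with hd | hd
    · have h1 := abs_add_le (c + 1) d
      have h2 := abs_sub c d
      rw [abs_of_nonneg hd] at h1 h2
      nlinarith
    · have h1 := abs_add_le c (d + 1)
      have h2 := abs_sub (c + 1) (d + 1)
      rw [abs_of_nonpos (by omega : d + 1 ≤ 0)] at h1 h2
      rw [show c + (d + 1) = c + 1 + d by ring] at h1
      rw [show c + 1 - (d + 1) = c - d by ring] at h2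
      nlinarith

lemma mul_le_four_mul_gain_of_two_le {x : ℤ} (hx : 2 ≤ x) (y : ℤ) :
    x * (x - 2 * y) ≤ 4 * gain x y := by
  rcases lt_or_ge x (2 * y) with hy | hy
  · have := gain_nonneg x y
    nlinarith
  obtain ⟨c, d, rfl, rfl⟩ | ⟨c, d, rfl, rfl⟩ := even_or_odd_split x y
  · rw [gain_of_even]
    rcases abs_cases (c + d) with ⟨h, h'⟩ | ⟨h, h'⟩ <;>
    rcases abs_cases c with ⟨k, k'⟩ | ⟨k, k'⟩ <;>
    rcases abs_cases (c - d) with ⟨l, l'⟩ | ⟨l, l'⟩ <;> rw [h, k, l] <;> nlinarith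
  · rw [gain_of_odd]
    rcases abs_cases (c + 1 + d) with ⟨h, h'⟩ | ⟨h, h'⟩ <;>
    rcases abs_cases c with ⟨k, k'⟩ | ⟨k, k'⟩ <;>
    rcases abs_cases (c + 1) with ⟨m, m'⟩ | ⟨m, m'⟩ <;>
    rcases abs_cases (c - d) with ⟨l, l'⟩ | ⟨l, l'⟩ <;> rw [h, k, l, m] <;>
    first | omega | nlinarith

/-- If the loads `x` have a mean of absolute value at most `1/2`, then the total gain over all
pairs is at least a quarter of `n` times the total potential. -/
lemma card_mul_sum_pot_le {V : Type} [Fintype V] (x : V → ℤ)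
    (hx : |2 * ∑ v, x v| ≤ Fintype.card V) :
    Fintype.card V * ∑ v, pot (x v) ≤ 4 * ∑ v, ∑ u, gain (x v) (x u) := by
  rw [Finset.mul_sum, Finset.mul_sum]
  refine Finset.sum_le_sum fun v _ => ?_
  obtain ⟨h1, h2⟩ := abs_le.1 hx
  have key : ∀ z : ℤ, ∑ u, z * (z - 2 * x u) =
      z * (Fintype.card V * z - 2 * ∑ u, x u) := by
    intro z
    rw [← Finset.mul_sum, Finset.sum_sub_distrib, ← Finset.mul_sum]
    simp
  rcases le_or_gt 2 (x v) with h | h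
  · have h3 : ∑ u, x v * (x v - 2 * x u) ≤ 4 * ∑ u, gain (x v) (x u) := by
      rw [Finset.mul_sum]
      exact Finset.sum_le_sum fun u _ => mul_le_four_mul_gain_of_two_le h _
    rw [key] at h3
    refine le_trans ?_ h3
    rw [pot, abs_of_nonneg (by omega)]
    nlinarith
  rcases le_or_gt (x v) (-2) with h' | h'
  · have h3 : ∑ u, x v * (x v - 2 * x u) ≤ 4 * ∑ u, gain (x v) (x u) := by
      rw [Finset.mul_sum]
      refine Finset.sum_le_sum fun u _ => ?_
      have := mul_le_four_mul_gain_of_two_le (x := - x v) (by omega) (- x u)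
      rw [gain_neg] at this
      linarith
    rw [key] at h3
    refine le_trans ?_ h3
    rw [pot, abs_of_nonpos (by omega)]
    nlinarith
  · have h0 : pot (x v) = 0 := by
      have : x v = -1 ∨ x v = 0 ∨ x v = 1 := by omega
      rcases this with h | h | h <;> rw [h] <;> rfl
    rw [h0, mul_zero]
    exact mul_nonneg (by norm_num) (Finset.sum_nonneg fun u _ => gain_nonneg _ _)

open Classical in
/-- Summing an additive functional `φ` of the loads over one step of a matching. -/
lemma two_mul_sum_add_sum_matched {V : Type} [Fintype V] (M : Set (Sym2 V))
    (hM : ∀ e ∈ M, ∀ f ∈ M, ∀ x : V, x ∈ e → x ∈ f → e = f) (x x' : V → ℕ)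
    (hun : ∀ v, (∀ u, s(v, u) ∉ M) → x' v = x v) (φ : ℕ → ℤ) :
    2 * ∑ v, φ (x' v) + ∑ v, ∑ u, (if s(v, u) ∈ M then
      φ (x v) + φ (x u) - φ (x' v) - φ (x' u) else 0) = 2 * ∑ v, φ (x v) := by
  have h1 : ∀ v, ∑ u, (if s(v, u) ∈ M then φ (x v) - φ (x' v) else 0) = φ (x v) - φ (x' v) := by
    intro v
    by_cases h : ∃ u, s(v, u) ∈ M
    · obtain ⟨u, hu⟩ := h
      rw [Finset.sum_eq_single u]
      · rw [if_pos hu]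
      · intro w _ hw
        rw [if_neg]
        intro hw'
        have := hM _ hw' _ hu v (Sym2.mem_mk_left _ _) (Sym2.mem_mk_left _ _)
        exact hw (Sym2.congr_right.1 this)
      · simp
    · push Not at h
      simp [hun v h]
  have h2 : ∑ v, ∑ u, (if s(v, u) ∈ M then φ (x u) - φ (x' u) else 0) =
      ∑ v, (φ (x v) - φ (x' v)) := by
    rw [Finset.sum_comm]
    refine Finset.sum_congr rfl fun v _ => ?_
    refine (Finset.sum_congr rfl fun u _ => ?_).trans (h1 v)
    rw [Sym2.eq_swap]
  have h3 : ∑ v, ∑ u, (if s(v, u) ∈ M then φ (x v) + φ (x u) - φ (x' v) - φ (x' u) else 0) =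
      ∑ v, ∑ u, (if s(v, u) ∈ M then φ (x v) - φ (x' v) else 0) +
      ∑ v, ∑ u, (if s(v, u) ∈ M then φ (x u) - φ (x' u) else 0) := by
    simp only [← Finset.sum_add_distrib]
    refine Finset.sum_congr rfl fun v _ => Finset.sum_congr rfl fun u _ => ?_
    split_ifs <;> ring
  rw [h3, h2, Finset.sum_congr rfl fun v _ => h1 v, Finset.sum_sub_distrib]
  ring

/-- The average of a discrete load vector is at distance at most `1/2` from its rounding. -/
lemma abs_two_mul_sum_sub_roundNear_le {V : Type} [Fintype V] [Nonempty V] (Γ₀ : V → ℕ) :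
    |2 * ∑ v, ((Γ₀ v : ℤ) - roundNear (avgLoad Γ₀))| ≤ Fintype.card V := by
  have hn : (0 : ℝ) < Fintype.card V := by exact_mod_cast Fintype.card_pos
  have hs : ∑ v, (Γ₀ v : ℝ) = Fintype.card V * avgLoad Γ₀ := by
    unfold avgLoad; field_simp
  have h1 := Int.le_ceil (avgLoad Γ₀ - 1 / 2)
  have h2 := Int.ceil_lt_add_one (avgLoad Γ₀ - 1 / 2)
  have h3 : |2 * ∑ v, ((Γ₀ v : ℝ) - (roundNear (avgLoad Γ₀) : ℝ))| ≤ Fintype.card V := by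
    rw [Finset.sum_sub_distrib, hs, Finset.sum_const, Finset.card_univ, nsmul_eq_mul]
    unfold roundNear
    rw [abs_le]
    constructor <;> nlinarith
  exact_mod_cast h3

lemma abs_sub_roundNear_le_disc {V : Type} [Fintype V] [Nonempty V] (Γ₀ : V → ℕ) (v : V) :
    |(Γ₀ v : ℤ) - roundNear (avgLoad Γ₀)| ≤ disc Γ₀ := by
  have hn : (0 : ℝ) < Fintype.card V := by exact_mod_cast Fintype.card_pos
  set a := Finset.univ.inf' Finset.univ_nonempty Γ₀ with ha
  set b := Finset.univ.sup Γ₀ with hb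
  have hav : ∀ v, a ≤ Γ₀ v := fun v => Finset.inf'_le _ (Finset.mem_univ v)
  have hbv : ∀ v, Γ₀ v ≤ b := fun v => Finset.le_sup (Finset.mem_univ v)
  have h1 : (a : ℝ) ≤ avgLoad Γ₀ := by
    unfold avgLoad
    rw [le_div_iff₀ hn]
    calc (a : ℝ) * Fintype.card V = ∑ _v : V, (a : ℝ) := by simp [mul_comm]
      _ ≤ _ := Finset.sum_le_sum fun v _ => by exact_mod_cast hav v
  have h2 : avgLoad Γ₀ ≤ b := by
    unfold avgLoad
    rw [div_le_iff₀ hn]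
    calc ∑ v, (Γ₀ v : ℝ) ≤ ∑ _v : V, (b : ℝ) := Finset.sum_le_sum fun v _ => by exact_mod_cast hbv v
      _ = _ := by simp [mul_comm]
  have h3 : (a : ℤ) ≤ roundNear (avgLoad Γ₀) := by
    unfold roundNear
    rw [Int.le_ceil_iff]
    push_cast
    linarith
  have h4 : roundNear (avgLoad Γ₀) ≤ b := by
    unfold roundNear
    rw [Int.ceil_le]
    push_cast
    linarith
  have hd : disc Γ₀ = b - a := rfl
  have := hav v
  have := hbv v
  rw [hd, abs_le]
  omega

/-- The total potential of a load configuration relative to the target load `m`. -/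
def totalPot {V : Type} [Fintype V] (m : ℤ) (x : V → ℕ) : ℕ := (∑ v, pot (x v - m)).toNat

lemma cast_totalPot {V : Type} [Fintype V] (m : ℤ) (x : V → ℕ) :
    (totalPot m x : ℤ) = ∑ v, pot (x v - m) :=
  Int.toNat_of_nonneg (Finset.sum_nonneg fun _ _ => pot_nonneg _)

lemma abs_sub_le_one_of_totalPot_lt_one {V : Type} [Fintype V] {m : ℤ} {x : V → ℕ}
    (h : totalPot m x < 1) (v : V) : |(x v : ℤ) - m| ≤ 1 := by
  refine abs_le_one_of_pot_lt_one (lt_of_le_of_lt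
    (Finset.single_le_sum (f := fun v => pot (x v - m)) (fun _ _ => pot_nonneg _)
      (Finset.mem_univ v)) ?_)
  rw [← cast_totalPot]
  exact_mod_cast h

lemma totalPot_le {V : Type} [Fintype V] [Nonempty V] (Γ₀ : V → ℕ) :
    totalPot (roundNear (avgLoad Γ₀)) Γ₀ ≤ Fintype.card V * disc Γ₀ ^ 2 := by
  zify
  rw [cast_totalPot]
  calc _ ≤ ∑ _v : V, (disc Γ₀ : ℤ) ^ 2 := by
        refine Finset.sum_le_sum fun v _ => ?_
        have h := abs_sub_roundNear_le_disc Γ₀ v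
        have h0 := abs_nonneg ((Γ₀ v : ℤ) - roundNear (avgLoad Γ₀))
        unfold pot
        rw [← sq_abs]
        nlinarith
    _ = _ := by simp

section

open MeasureTheory ProbabilityTheory

lemma mul_lintegral_le_setLIntegral {Ω : Type*} {m m0 : MeasurableSpace Ω} (hm : m ≤ m0)
    (μ : Measure Ω) (A : Set Ω) (c : ENNReal)
    (h : ∀ E, MeasurableSet[m] E → c * μ E ≤ μ (E ∩ A)) {f : Ω → ENNReal} (hf : Measurable[m] f) :
    c * ∫⁻ ω, f ω ∂μ ≤ ∫⁻ ω in A, f ω ∂μ := by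
  rw [← lintegral_trim hm hf, ← lintegral_trim hm hf, ← smul_eq_mul,
    ← lintegral_smul_measure]
  refine lintegral_mono' (Measure.le_iff.2 fun E hE => ?_) le_rfl
  rw [Measure.smul_apply, smul_eq_mul, trim_measurableSet_eq hm hE,
    trim_measurableSet_eq hm hE, Measure.restrict_apply (hm _ hE)]
  exact h E hE

lemma sum_le_mul_sum_div {ι : Type*} (s : Finset ι) (w d : ι → ℝ) (hw : ∀ i ∈ s, 0 ≤ w i)
    (hd : ∀ i ∈ s, 0 < d i) {D : ℝ} (hD : 0 < D) (h : ∑ i ∈ s, w i * d i ≤ D * ∑ i ∈ s, w i) :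
    ∑ i ∈ s, w i ≤ D * ∑ i ∈ s, w i / d i := by
  have h1 : ∑ i ∈ s, (2 * w i - w i * d i / D) ≤ ∑ i ∈ s, D * (w i / d i) := by
    refine Finset.sum_le_sum fun i hi => ?_
    have h2 : D * (w i / d i) - (2 * w i - w i * d i / D) = w i * (D - d i) ^ 2 / (d i * D) := by
      have := (hd i hi).ne'
      field_simp
      ring
    have h3 : 0 ≤ w i * (D - d i) ^ 2 / (d i * D) :=
      div_nonneg (mul_nonneg (hw i hi) (sq_nonneg _)) (mul_pos (hd i hi) hD).le
    linarith
  rw [Finset.sum_sub_distrib, ← Finset.mul_sum, ← Finset.mul_sum, ← Finset.sum_div] at h1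
  have h4 : (∑ i ∈ s, w i * d i) / D ≤ ∑ i ∈ s, w i := by
    rw [div_le_iff₀ hD]
    linarith
  linarith

open Classical in
lemma cast_gdeg {V : Type} [Fintype V] (Gr : SimpleGraph V) (u : V) :
    (gdeg Gr u : ℝ) = ∑ w, if Gr.Adj u w then 1 else 0 := by
  unfold gdeg
  rw [Nat.card_eq_fintype_card, Fintype.card_subtype]
  simp

namespace EMLoadProcess

variable {V : Type} [Fintype V] [DecidableEq V] (P : EMLoadProcess V)

attribute [local instance] EMLoadProcess.mΩ EMLoadProcess.isProb

lemma measurableSet_G {t k : ℕ} (h : t < k) (s : Set (SimpleGraph V)) :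
    MeasurableSet[P.hist k] {ω | P.G t ω ∈ s} :=
  P.hist_mono h _ (P.meas_G t (MeasurableSpace.measurableSet_top (s := s)))

lemma measurableSet_M {t k : ℕ} (h : t < k) (s : Set (Set (Sym2 V))) :
    MeasurableSet[P.hist k] {ω | P.M t ω ∈ s} :=
  P.hist_mono h _ (P.meas_M t (MeasurableSpace.measurableSet_top (s := s)))

lemma measurableSet_edge (t : ℕ) (e : Sym2 V) : MeasurableSet {ω | e ∈ (P.G t ω).edgeSet} :=
  P.hist_le _ _ (P.measurableSet_G t.lt_succ_self {G | e ∈ G.edgeSet})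

lemma measurableSet_matched (t : ℕ) (e : Sym2 V) : MeasurableSet {ω | e ∈ P.M t ω} :=
  P.hist_le _ _ (P.measurableSet_M t.lt_succ_self {M | e ∈ M})

lemma min_mul_le_and_le_max_mul {t : ℕ} {H : SimpleGraph V} {E : Set P.Ω}
    (hE : MeasurableSet[P.hist (t + 1)] E) (hEH : E ⊆ {ω | P.G t ω = H}) {e : Sym2 V}
    (he : ¬ e.IsDiag) :
    min P.p (1 - P.q) * P.μ.real E ≤ P.μ.real (E ∩ {ω | e ∈ (P.G (t + 1) ω).edgeSet}) ∧
    P.μ.real (E ∩ {ω | e ∈ (P.G (t + 1) ω).edgeSet}) ≤ max P.p (1 - P.q) * P.μ.real E := by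
  by_cases h0 : P.μ E = 0
  · have h1 : P.μ (E ∩ {ω | e ∈ (P.G (t + 1) ω).edgeSet}) = 0 :=
      measure_mono_null Set.inter_subset_left h0
    simp [measureReal_def, h0, h1]
  have key : ∀ c : ℝ, 0 ≤ c →
      cond P.μ E {ω | e ∈ (P.G (t + 1) ω).edgeSet} = ENNReal.ofReal c →
      P.μ.real (E ∩ {ω | e ∈ (P.G (t + 1) ω).edgeSet}) = c * P.μ.real E := by
    intro c hc h
    have h1 := cond_mul_eq_inter (P.hist_le _ _ hE)
      {ω | e ∈ (P.G (t + 1) ω).edgeSet} P.μ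
    rw [h] at h1
    rw [measureReal_def, ← h1, ENNReal.toReal_mul, ENNReal.toReal_ofReal hc,
      measureReal_def]
  have hq := P.q_lt_one
  by_cases h : e ∈ H.edgeSet
  · rw [key _ (by linarith) (P.markov_edge t H E hE h0 hEH e he h)]
    exact ⟨by gcongr; exact min_le_right _ _, by gcongr; exact le_max_right _ _⟩
  · rw [key _ P.p_pos.le (P.markov_nonedge t H E hE h0 hEH e he h)]
    exact ⟨by gcongr; exact min_le_left _ _, by gcongr; exact le_max_left _ _⟩

lemma measureReal_inter_edge_inter_edge_le {t : ℕ} {H : SimpleGraph V} {E : Set P.Ω}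
    (hE : MeasurableSet[P.hist (t + 1)] E) (hEH : E ⊆ {ω | P.G t ω = H}) {e f : Sym2 V}
    (he : ¬ e.IsDiag) (hf : ¬ f.IsDiag) (hef : e ≠ f) :
    P.μ.real (E ∩ {ω | e ∈ (P.G (t + 1) ω).edgeSet} ∩ {ω | f ∈ (P.G (t + 1) ω).edgeSet}) ≤
      max P.p (1 - P.q) * P.μ.real (E ∩ {ω | e ∈ (P.G (t + 1) ω).edgeSet}) := by
  set A := {ω | e ∈ (P.G (t + 1) ω).edgeSet} with hA
  set B := {ω | f ∈ (P.G (t + 1) ω).edgeSet} with hB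
  by_cases h0 : P.μ E = 0
  · have h1 : P.μ (E ∩ A) = 0 := measure_mono_null Set.inter_subset_left h0
    have h2 : P.μ (E ∩ A ∩ B) = 0 := measure_mono_null Set.inter_subset_left h1
    simp [measureReal_def, h1, h2]
  have hpos : 0 < P.μ.real E :=
    ENNReal.toReal_pos h0 (measure_ne_top _ _)
  have hi := (P.markov_indep t H E hE h0 hEH).meas_biInter {⟨e, he⟩, ⟨f, hf⟩}
  have hne : (⟨e, he⟩ : {e : Sym2 V // ¬e.IsDiag}) ≠ ⟨f, hf⟩ := fun h => hef (Subtype.ext_iff.1 h)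
  rw [Finset.prod_pair hne] at hi
  simp only [Finset.mem_insert, Finset.mem_singleton, Set.iInter_iInter_eq_or_left,
    Set.iInter_iInter_eq_left] at hi
  rw [← hA, ← hB] at hi
  have hE' := P.hist_le _ _ hE
  rw [cond_apply hE', cond_apply hE',
    cond_apply hE', ← Set.inter_assoc] at hi
  have hr := congrArg ENNReal.toReal hi
  simp only [ENNReal.toReal_mul, ENNReal.toReal_inv, ← measureReal_def] at hr
  have hb := (P.min_mul_le_and_le_max_mul hE hEH hf).2
  rw [← hB] at hb
  have h3 : P.μ.real (E ∩ A ∩ B) = P.μ.real (E ∩ A) * ((P.μ.real E)⁻¹ * P.μ.real (E ∩ B)) := by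
    field_simp at hr ⊢
    linarith
  have h4 : (P.μ.real E)⁻¹ * P.μ.real (E ∩ B) ≤ max P.p (1 - P.q) := by
    rw [inv_mul_le_iff₀ hpos]
    linarith
  rw [h3, mul_comm (max _ _)]
  gcongr

lemma Fair.div_mul_le {P : EMLoadProcess V} {F : ℝ} (hF : P.Fair F) (hF0 : 0 < F) (t : ℕ)
    {Gr : SimpleGraph V} {u v : V} (huv : Gr.Adj u v) {E : Set P.Ω}
    (hE : MeasurableSet[P.hist t] E) :
    F / (max (gdeg Gr u) (gdeg Gr v) : ℝ) * P.μ.real (E ∩ {ω | P.G t ω = Gr}) ≤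
      P.μ.real (E ∩ {ω | s(u, v) ∈ P.M t ω} ∩ {ω | P.G t ω = Gr}) := by
  have hm : MeasurableSet ({ω | P.G t ω = Gr} ∩ E) :=
    (P.hist_le _ _ (P.measurableSet_G t.lt_succ_self {Gr})).inter (P.hist_le _ _ hE)
  rw [Set.inter_comm E, Set.inter_right_comm, Set.inter_comm E]
  by_cases h0 : P.μ ({ω | P.G t ω = Gr} ∩ E) = 0
  · have h0' : P.μ.real ({ω | P.G t ω = Gr} ∩ E) = 0 := by simp [measureReal_def, h0]
    rw [h0', mul_zero]
    exact measureReal_nonneg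
  have h1 := hF t Gr u v huv E hE h0
  have h2 := cond_mul_eq_inter hm {ω | s(u, v) ∈ P.M t ω} P.μ
  have hc : 0 ≤ F / (max (gdeg Gr u) (gdeg Gr v) : ℝ) := by positivity
  rw [measureReal_def, measureReal_def, ← h2,
    ← ENNReal.toReal_ofReal hc, ← ENNReal.toReal_mul]
  refine ENNReal.toReal_mono ?_ (by gcongr)
  rw [h2]
  exact measure_ne_top _ _

open Classical in
lemma measureReal_inter_eq_sum {t : ℕ} (E : Set P.Ω) (s : Finset (SimpleGraph V)) :
    P.μ.real (E ∩ {ω | P.G t ω ∈ s}) = ∑ Gr ∈ s, P.μ.real (E ∩ {ω | P.G t ω = Gr}) := by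
  have h := sum_measureReal_preimage_singleton (μ := P.μ.restrict E) s (f := P.G t)
    (fun y _ => P.hist_le _ _ (P.measurableSet_G t.lt_succ_self {y}))
  have h1 : ∀ s : Set (SimpleGraph V), MeasurableSet {ω | P.G t ω ∈ s} := fun s =>
    P.hist_le _ _ (P.measurableSet_G t.lt_succ_self s)
  have h2 : ∀ s : Set (SimpleGraph V),
      (P.μ.restrict E).real (P.G t ⁻¹' s) = P.μ.real (E ∩ {ω | P.G t ω ∈ s}) := fun s =>
    (measureReal_restrict_apply (h1 s)).trans (by rw [Set.inter_comm])
  simp only [h2] at h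
  exact h.symm

open Classical in
lemma sum_mul_gdeg_le {t : ℕ} {H : SimpleGraph V} {E : Set P.Ω}
    (hE : MeasurableSet[P.hist (t + 1)] E) (hEH : E ⊆ {ω | P.G t ω = H}) {u v : V} (huv : u ≠ v) :
    ∑ Gr : SimpleGraph V with s(u, v) ∈ Gr.edgeSet,
      P.μ.real (E ∩ {ω | P.G (t + 1) ω = Gr}) * gdeg Gr u ≤
      (1 + Fintype.card V * max P.p (1 - P.q)) *
        P.μ.real (E ∩ {ω | s(u, v) ∈ (P.G (t + 1) ω).edgeSet}) := by
  set a := max P.p (1 - P.q)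
  have ha0 : 0 ≤ a := P.p_pos.le.trans (le_max_left _ _)
  set m := P.μ.real (E ∩ {ω | s(u, v) ∈ (P.G (t + 1) ω).edgeSet})
  have hm0 : 0 ≤ m := measureReal_nonneg
  simp only [cast_gdeg, Finset.mul_sum]
  rw [Finset.sum_comm]
  calc _ ≤ ∑ x : V, (a + if x = v then 1 else 0) * m := ?_
    _ = _ := by
      rw [← Finset.sum_mul, Finset.sum_add_distrib]
      simp [add_comm]
  refine Finset.sum_le_sum fun x _ => ?_
  simp only [mul_ite, mul_one, mul_zero]
  rw [← Finset.sum_filter, Finset.filter_filter,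
    ← P.measureReal_inter_eq_sum]
  have hset : E ∩ {ω | P.G (t + 1) ω ∈ Finset.univ.filter
        fun Gr : SimpleGraph V => s(u, v) ∈ Gr.edgeSet ∧ Gr.Adj u x} =
      E ∩ {ω | s(u, v) ∈ (P.G (t + 1) ω).edgeSet} ∩ {ω | s(u, x) ∈ (P.G (t + 1) ω).edgeSet} := by
    ext ω
    simp [and_assoc]
  rw [hset]
  by_cases hxv : x = v
  · rw [if_pos hxv]
    have h1 : P.μ.real (E ∩ {ω | s(u, v) ∈ (P.G (t + 1) ω).edgeSet} ∩
      {ω | s(u, x) ∈ (P.G (t + 1) ω).edgeSet}) ≤ m := measureReal_mono Set.inter_subset_left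
    nlinarith
  rw [if_neg hxv, add_zero]
  by_cases hxu : x = u
  · have h1 : E ∩ {ω | s(u, v) ∈ (P.G (t + 1) ω).edgeSet} ∩
        {ω | s(u, x) ∈ (P.G (t + 1) ω).edgeSet} = ∅ := by
      subst hxu
      ext ω
      simp
    rw [h1, measureReal_empty]
    positivity
  · refine P.measureReal_inter_edge_inter_edge_le hE hEH (by simpa using huv)
      (by simpa using Ne.symm hxu) fun h => hxv ?_
    exact (Sym2.congr_right.1 h).symm

open Classical in
lemma Fair.mul_le_of_subset {P : EMLoadProcess V} {F : ℝ} (hF : P.Fair F) (hF0 : 0 < F) {t : ℕ}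
    {H : SimpleGraph V} {E : Set P.Ω} (hE : MeasurableSet[P.hist (t + 1)] E)
    (hEH : E ⊆ {ω | P.G t ω = H}) {u v : V} (huv : u ≠ v) :
    F * min P.p (1 - P.q) / (2 * (1 + Fintype.card V * max P.p (1 - P.q))) * P.μ.real E ≤
      P.μ.real (E ∩ {ω | s(u, v) ∈ P.M (t + 1) ω}) := by
  have ha0 : 0 < max P.p (1 - P.q) := P.p_pos.trans_le (le_max_left _ _)
  have hD : 0 < 2 * (1 + Fintype.card V * max P.p (1 - P.q)) := by positivity
  set D := 2 * (1 + Fintype.card V * max P.p (1 - P.q)) with hDdef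
  set S := Finset.univ.filter fun Gr : SimpleGraph V => s(u, v) ∈ Gr.edgeSet with hS
  have hadj : ∀ Gr ∈ S, Gr.Adj u v := fun Gr h => by simpa [hS] using h
  have hsum : P.μ.real (E ∩ {ω | s(u, v) ∈ (P.G (t + 1) ω).edgeSet}) =
      ∑ Gr ∈ S, P.μ.real (E ∩ {ω | P.G (t + 1) ω = Gr}) := by
    rw [← P.measureReal_inter_eq_sum]
    simp [hS]
  have hdpos : ∀ Gr ∈ S, 0 < max (gdeg Gr u : ℝ) (gdeg Gr v) := fun Gr h => by
    refine lt_max_of_lt_left ?_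
    have : Nonempty {w : V // Gr.Adj u w} := ⟨⟨v, hadj Gr h⟩⟩
    exact_mod_cast (Nat.card_pos : 0 < Nat.card {w : V // Gr.Adj u w})
  have hmean := sum_le_mul_sum_div S (fun Gr => P.μ.real (E ∩ {ω | P.G (t + 1) ω = Gr}))
    (fun Gr => (max (gdeg Gr u) (gdeg Gr v) : ℝ)) (fun _ _ => measureReal_nonneg) hdpos hD (by
      have h1 := P.sum_mul_gdeg_le hE hEH huv
      have h2 := P.sum_mul_gdeg_le hE hEH huv.symm
      rw [Sym2.eq_swap] at h2
      rw [← hsum]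
      calc _ ≤ ∑ Gr ∈ S, (P.μ.real (E ∩ {ω | P.G (t + 1) ω = Gr}) * gdeg Gr u +
              P.μ.real (E ∩ {ω | P.G (t + 1) ω = Gr}) * gdeg Gr v) := by
            refine Finset.sum_le_sum fun Gr _ => ?_
            rw [← mul_add]
            exact mul_le_mul_of_nonneg_left (max_le_add_of_nonneg (by positivity) (by positivity))
              measureReal_nonneg
        _ ≤ _ := by
            rw [Finset.sum_add_distrib, hDdef]
            linarith)
  have hfair : F * ∑ Gr ∈ S, P.μ.real (E ∩ {ω | P.G (t + 1) ω = Gr}) /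
      (max (gdeg Gr u) (gdeg Gr v) : ℝ) ≤ P.μ.real (E ∩ {ω | s(u, v) ∈ P.M (t + 1) ω}) := by
    calc _ ≤ ∑ Gr ∈ S, P.μ.real (E ∩ {ω | s(u, v) ∈ P.M (t + 1) ω} ∩
          {ω | P.G (t + 1) ω = Gr}) := by
          rw [Finset.mul_sum]
          refine Finset.sum_le_sum fun Gr hGr => ?_
          refine le_of_eq_of_le ?_ (hF.div_mul_le hF0 (t + 1) (hadj Gr hGr) hE)
          ring
      _ = P.μ.real (E ∩ {ω | s(u, v) ∈ P.M (t + 1) ω} ∩ {ω | P.G (t + 1) ω ∈ S}) :=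
          (P.measureReal_inter_eq_sum _ S).symm
      _ ≤ _ := measureReal_mono Set.inter_subset_left
  have hb := (P.min_mul_le_and_le_max_mul hE hEH (e := s(u, v)) (by simpa using huv)).1
  rw [hsum] at hb
  rw [div_mul_eq_mul_div, div_le_iff₀ hD]
  calc F * min P.p (1 - P.q) * P.μ.real E = F * (min P.p (1 - P.q) * P.μ.real E) := by ring
    _ ≤ F * (D * ∑ Gr ∈ S, P.μ.real (E ∩ {ω | P.G (t + 1) ω = Gr}) /
      (max (gdeg Gr u) (gdeg Gr v) : ℝ)) :=
        mul_le_mul_of_nonneg_left (hb.trans hmean) hF0.le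
    _ = (F * ∑ Gr ∈ S, P.μ.real (E ∩ {ω | P.G (t + 1) ω = Gr}) /
      (max (gdeg Gr u) (gdeg Gr v) : ℝ)) * D := by ring
    _ ≤ _ := by gcongr

open Classical in
/-- From the second step on, every pair of vertices is matched with conditional probability
bounded below, uniformly in the history. -/
lemma Fair.mul_le {P : EMLoadProcess V} {F : ℝ} (hF : P.Fair F) (hF0 : 0 < F) {t : ℕ}
    {E : Set P.Ω} (hE : MeasurableSet[P.hist (t + 1)] E) {u v : V} (huv : u ≠ v) :
    F * min P.p (1 - P.q) / (2 * (1 + Fintype.card V * max P.p (1 - P.q))) * P.μ.real E ≤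
      P.μ.real (E ∩ {ω | s(u, v) ∈ P.M (t + 1) ω}) := by
  have h1 := P.measureReal_inter_eq_sum (t := t) E Finset.univ
  have h2 := P.measureReal_inter_eq_sum (t := t)
    (E ∩ {ω | s(u, v) ∈ P.M (t + 1) ω}) Finset.univ
  simp only [Finset.mem_univ, Set.ofPred_true, Set.inter_univ] at h1 h2
  rw [h1, h2, Finset.mul_sum]
  refine Finset.sum_le_sum fun H _ => ?_
  rw [Set.inter_right_comm]
  exact hF.mul_le_of_subset hF0 (hE.inter (P.measurableSet_G t.lt_succ_self {H}))
    Set.inter_subset_right huv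

/-- The lower bound on the matching probabilities in terms of `θ`, `r` and `n`. -/
lemma div_le_matching_rate {F θ : ℝ} (hF0 : 0 < F) (hθ : 0 < θ) [Nonempty V]
    (h : θ / (Fintype.card V : ℝ) ≤ max P.p (1 - P.q)) :
    F * θ / (2 * (1 + θ)) / (P.r * Fintype.card V) ≤
      F * min P.p (1 - P.q) / (2 * (1 + Fintype.card V * max P.p (1 - P.q))) := by
  have hn : (0 : ℝ) < Fintype.card V := by exact_mod_cast Fintype.card_pos
  have hp := P.p_pos
  have hq : 0 < 1 - P.q := by linarith [P.q_lt_one]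
  have ha0 : 0 < max P.p (1 - P.q) := hp.trans_le (le_max_left _ _)
  have hb0 : 0 < min P.p (1 - P.q) := lt_min hp hq
  have hr : P.r = max P.p (1 - P.q) / min P.p (1 - P.q) := by
    unfold EMLoadProcess.r
    rcases le_total P.p (1 - P.q) with h | h
    · rw [max_eq_right h, min_eq_left h, max_eq_right]
      exact ((div_le_one hq).2 h).trans ((one_le_div hp).2 h)
    · rw [max_eq_left h, min_eq_right h, max_eq_left]
      exact ((div_le_one hp).2 h).trans ((one_le_div hq).2 h)
  rw [hr]
  rw [div_le_iff₀ hn] at h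
  set a := max P.p (1 - P.q)
  set b := min P.p (1 - P.q)
  rw [div_div, div_le_div_iff₀ (by positivity) (by positivity)]
  have : F * b * (2 * (1 + θ) * (a / b * Fintype.card V)) =
      2 * F * (1 + θ) * (a * Fintype.card V) := by
    field_simp
  rw [this]
  have h2 : 0 ≤ F * (a * Fintype.card V - θ) := mul_nonneg hF0.le (by linarith)
  nlinarith

lemma one_le_r : 1 ≤ P.r := by
  have hp := P.p_pos
  have hq : 0 < 1 - P.q := by linarith [P.q_lt_one]
  unfold EMLoadProcess.r
  rcases le_total P.p (1 - P.q) with h | h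
  · exact le_max_of_le_right ((one_le_div hp).2 h)
  · exact le_max_of_le_left ((one_le_div hq).2 h)

lemma sum_Γ (m : ℤ) (t : ℕ) (ω : P.Ω) :
    ∑ v, ((P.Γ t ω v : ℤ) - m) = ∑ v, ((P.Γ 0 ω v : ℤ) - m) := by
  classical
  induction t with
  | zero => rfl
  | succ t ih =>
    rw [← ih]
    have h := two_mul_sum_add_sum_matched (P.M t ω) (P.M_matching t ω) (P.Γ t ω) (P.Γ (t + 1) ω)
      (P.unmatched t ω) fun k => (k : ℤ) - m
    rw [Finset.sum_eq_zero (s := Finset.univ) (f := fun v => ∑ u, _)] at h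
    · linarith
    · refine fun v _ => Finset.sum_eq_zero fun u _ => ?_
      split_ifs with hM
      · rcases P.matched t ω v u hM with ⟨h1, h2⟩ | ⟨h1, h2⟩ <;>
          (rw [h1, h2]; push_cast; omega)
      · rfl

open Classical in
lemma totalPot_step (m : ℤ) (t : ℕ) (ω : P.Ω) :
    2 * totalPot m (P.Γ (t + 1) ω) + ∑ v, ∑ u, (if s(v, u) ∈ P.M t ω then
      (gain (P.Γ t ω v - m) (P.Γ t ω u - m)).toNat else 0) = 2 * totalPot m (P.Γ t ω) := by
  have h := two_mul_sum_add_sum_matched (P.M t ω) (P.M_matching t ω) (P.Γ t ω) (P.Γ (t + 1) ω)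
    (P.unmatched t ω) fun k => pot ((k : ℤ) - m)
  zify
  rw [cast_totalPot, cast_totalPot, ← h]
  congr 1
  refine Finset.sum_congr rfl fun v _ => Finset.sum_congr rfl fun u _ => ?_
  split_ifs with hM
  · rw [Int.toNat_of_nonneg (gain_nonneg _ _), gain]
    have e1 : ((P.Γ t ω v : ℤ) - m + (P.Γ t ω u - m) + 1) / 2 =
        ((P.Γ t ω v + P.Γ t ω u + 1) / 2 : ℕ) - m := by push_cast; omega
    have e2 : ((P.Γ t ω v : ℤ) - m + (P.Γ t ω u - m)) / 2 =
        ((P.Γ t ω v + P.Γ t ω u) / 2 : ℕ) - m := by push_cast; omega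
    rw [e1, e2]
    rcases P.matched t ω v u hM with ⟨h1, h2⟩ | ⟨h1, h2⟩
    · rw [h1, h2]
    · rw [h1, h2]
      ring
  · rfl

lemma totalPot_le_zero (m : ℤ) (t : ℕ) (ω : P.Ω) :
    totalPot m (P.Γ t ω) ≤ totalPot m (P.Γ 0 ω) := by
  induction t with
  | zero => rfl
  | succ t ih => have := P.totalPot_step m t ω; omega

lemma eight_mul_lintegral_totalPot_add_le {m : ℤ} {t : ℕ}
    (hm : ∀ ω, |2 * ∑ v, ((P.Γ 0 ω v : ℤ) - m)| ≤ Fintype.card V) (ε : ENNReal)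
    (hε : ∀ u v : V, u ≠ v → ∀ E, MeasurableSet[P.hist t] E →
      ε * P.μ E ≤ P.μ (E ∩ {ω | s(u, v) ∈ P.M t ω})) :
    8 * ∫⁻ ω, (totalPot m (P.Γ (t + 1) ω) : ENNReal) ∂P.μ +
      ε * (Fintype.card V * ∫⁻ ω, (totalPot m (P.Γ t ω) : ENNReal) ∂P.μ) ≤
      8 * ∫⁻ ω, (totalPot m (P.Γ t ω) : ENNReal) ∂P.μ := by
  classical
  set g : V → V → P.Ω → ENNReal :=
    fun v u ω => ((gain (P.Γ t ω v - m) (P.Γ t ω u - m)).toNat : ENNReal) with hg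
  have hmeas : ∀ (k : ℕ) (f : (V → ℕ) → ENNReal), Measurable[P.hist k] fun ω => f (P.Γ k ω) :=
    fun k f => measurable_from_top.comp (P.meas_Γ k)
  have hmeas' : ∀ (k : ℕ) (f : (V → ℕ) → ENNReal), Measurable fun ω => f (P.Γ k ω) :=
    fun k f => (hmeas k f).mono (P.hist_le k) le_rfl
  have hgm : ∀ v u, Measurable[P.hist t] (g v u) := fun v u =>
    hmeas t fun x => ((gain (x v - m) (x u - m)).toNat : ENNReal)
  have hgm' : ∀ v u, Measurable (g v u) := fun v u => (hgm v u).mono (P.hist_le t) le_rfl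
  have hpm : ∀ k, Measurable fun ω => (totalPot m (P.Γ k ω) : ENNReal) := fun k =>
    hmeas' k fun x => (totalPot m x : ENNReal)
  have hMm : ∀ v u, MeasurableSet {ω | s(v, u) ∈ P.M t ω} := fun v u =>
    P.measurableSet_matched t _
  have hstep : 2 * ∫⁻ ω, (totalPot m (P.Γ (t + 1) ω) : ENNReal) ∂P.μ +
      ∑ v, ∑ u, ∫⁻ ω in {ω | s(v, u) ∈ P.M t ω}, g v u ω ∂P.μ =
      2 * ∫⁻ ω, (totalPot m (P.Γ t ω) : ENNReal) ∂P.μ := by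
    rw [← lintegral_const_mul _ (hpm _), ← lintegral_const_mul _ (hpm _)]
    simp only [← lintegral_indicator (hMm _ _)]
    have h1 : ∀ v, ∑ u, ∫⁻ ω, {ω | s(v, u) ∈ P.M t ω}.indicator (g v u) ω ∂P.μ =
        ∫⁻ ω, ∑ u, {ω | s(v, u) ∈ P.M t ω}.indicator (g v u) ω ∂P.μ := fun v =>
      (lintegral_finsetSum _ fun u _ => (hgm' v u).indicator (hMm v u)).symm
    simp only [h1]
    rw [← lintegral_finsetSum _ fun v _ =>
      Finset.measurable_sum _ fun u _ => (hgm' v u).indicator (hMm v u),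
      ← lintegral_add_left ((hpm _).const_mul _)]
    refine lintegral_congr fun ω => ?_
    have h2 := congrArg (Nat.cast : ℕ → ENNReal) (P.totalPot_step m t ω)
    push_cast at h2
    rw [← h2]
    congr 1
  have hlower : ∀ v u, ε * ∫⁻ ω, g v u ω ∂P.μ ≤
      ∫⁻ ω in {ω | s(v, u) ∈ P.M t ω}, g v u ω ∂P.μ := by
    intro v u
    by_cases huv : v = u
    · subst huv
      simp [hg, gain_self]
    · exact mul_lintegral_le_setLIntegral (P.hist_le t) P.μ _ ε (hε v u huv) (hgm v u)
  have hgain : Fintype.card V * ∫⁻ ω, (totalPot m (P.Γ t ω) : ENNReal) ∂P.μ ≤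
      4 * ∑ v, ∑ u, ∫⁻ ω, g v u ω ∂P.μ := by
    have h1 : ∀ v, ∑ u, ∫⁻ ω, g v u ω ∂P.μ = ∫⁻ ω, ∑ u, g v u ω ∂P.μ := fun v =>
      (lintegral_finsetSum _ fun u _ => hgm' v u).symm
    simp only [h1]
    rw [← lintegral_finsetSum _ fun v _ => Finset.measurable_sum _ fun u _ => hgm' v u,
      ← lintegral_const_mul _ (hpm _), ← lintegral_const_mul _
        (Finset.measurable_sum _ fun v _ => Finset.measurable_sum _ fun u _ => hgm' v u)]
    refine lintegral_mono fun ω => ?_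
    have h2 := card_mul_sum_pot_le (fun v => (P.Γ t ω v : ℤ) - m) (by rw [P.sum_Γ]; exact hm ω)
    have h3 : Fintype.card V * totalPot m (P.Γ t ω) ≤
        4 * ∑ v, ∑ u, (gain (P.Γ t ω v - m) (P.Γ t ω u - m)).toNat := by
      zify
      simp only [Int.toNat_of_nonneg (gain_nonneg _ _), cast_totalPot]
      exact h2
    have h4 := Nat.cast_le (α := ENNReal).2 h3
    push_cast at h4
    exact h4
  calc _ ≤ 8 * ∫⁻ ω, (totalPot m (P.Γ (t + 1) ω) : ENNReal) ∂P.μ +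
        ε * (4 * ∑ v, ∑ u, ∫⁻ ω, g v u ω ∂P.μ) := by gcongr
    _ = 4 * (2 * ∫⁻ ω, (totalPot m (P.Γ (t + 1) ω) : ENNReal) ∂P.μ +
        ∑ v, ∑ u, ε * ∫⁻ ω, g v u ω ∂P.μ) := by
        simp only [← Finset.mul_sum]
        ring
    _ ≤ 4 * (2 * ∫⁻ ω, (totalPot m (P.Γ (t + 1) ω) : ENNReal) ∂P.μ +
        ∑ v, ∑ u, ∫⁻ ω in {ω | s(v, u) ∈ P.M t ω}, g v u ω ∂P.μ) := by
        gcongr with v _ u _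
        exact hlower v u
    _ = _ := by
        rw [hstep]
        ring

/-- Geometric decay of the expected potential. -/
lemma Fair.lintegral_totalPot_le {P : EMLoadProcess V} {F θ : ℝ} [Nonempty V] (hF : P.Fair F)
    (hF0 : 0 < F) (hθ : 0 < θ)
    (hpq : θ / (Fintype.card V : ℝ) ≤ max P.p (1 - P.q)) {Γ₀ : V → ℕ} (h0 : ∀ ω, P.Γ 0 ω = Γ₀)
    (T : ℕ) :
    ∫⁻ ω, (totalPot (roundNear (avgLoad Γ₀)) (P.Γ (T + 1) ω) : ENNReal) ∂P.μ ≤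
      ENNReal.ofReal (Real.exp (-(F * θ / (16 * (1 + θ)) / P.r) * T) *
        (Fintype.card V * (disc Γ₀ : ℝ) ^ 2)) := by
  have hn : (0 : ℝ) < Fintype.card V := by exact_mod_cast Fintype.card_pos
  have hr := P.one_le_r
  set m := roundNear (avgLoad Γ₀)
  set ε := F * θ / (2 * (1 + θ)) / (P.r * Fintype.card V) with hε
  set κ := F * θ / (16 * (1 + θ)) / P.r with hκ
  have hεκ : ε * Fintype.card V = 8 * κ := by
    rw [hε, hκ]
    field_simp
    norm_num
  have hε0 : 0 ≤ ε := by positivity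
  have hbound : ∀ t ω, (totalPot m (P.Γ t ω) : ENNReal) ≤
      ENNReal.ofReal (Fintype.card V * (disc Γ₀ : ℝ) ^ 2) := by
    intro t ω
    have h1 : totalPot m (P.Γ t ω) ≤ Fintype.card V * disc Γ₀ ^ 2 :=
      (P.totalPot_le_zero m t ω).trans (by rw [h0 ω]; exact totalPot_le Γ₀)
    rw [← ENNReal.ofReal_natCast]
    exact ENNReal.ofReal_le_ofReal (by exact_mod_cast h1)
  have hI : ∀ t, ∫⁻ ω, (totalPot m (P.Γ t ω) : ENNReal) ∂P.μ ≤
      ENNReal.ofReal (Fintype.card V * (disc Γ₀ : ℝ) ^ 2) := fun t =>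
    (lintegral_mono (hbound t)).trans (by simp)
  have hfin : ∀ t, ∫⁻ ω, (totalPot m (P.Γ t ω) : ENNReal) ∂P.μ ≠ ⊤ := fun t =>
    ((hI t).trans_lt ENNReal.ofReal_lt_top).ne
  induction T with
  | zero => simpa using hI 1
  | succ T ih =>
    have hrec := P.eight_mul_lintegral_totalPot_add_le (m := m) (t := T + 1)
      (fun ω => by rw [h0 ω]; exact abs_two_mul_sum_sub_roundNear_le Γ₀) (ENNReal.ofReal ε)
      (fun u v huv E hE => by
        have h1 := hF.mul_le hF0 hE huv
        have h2 := P.div_le_matching_rate hF0 hθ hpq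
        have h3 : ε * P.μ.real E ≤ P.μ.real (E ∩ {ω | s(u, v) ∈ P.M (T + 1) ω}) :=
          (mul_le_mul_of_nonneg_right h2 measureReal_nonneg).trans h1
        rw [← ofReal_measureReal (measure_ne_top P.μ E),
          ← ofReal_measureReal (measure_ne_top P.μ (E ∩ _)), ← ENNReal.ofReal_mul hε0]
        exact ENNReal.ofReal_le_ofReal h3)
    have hA := hfin (T + 1)
    have hB := hfin (T + 1 + 1)
    set A := ∫⁻ ω, (totalPot m (P.Γ (T + 1) ω) : ENNReal) ∂P.μ
    set B := ∫⁻ ω, (totalPot m (P.Γ (T + 1 + 1) ω) : ENNReal) ∂P.μ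
    have hreal := ENNReal.toReal_mono (ENNReal.mul_ne_top (by norm_num) hA) hrec
    rw [ENNReal.toReal_add (ENNReal.mul_ne_top (by norm_num) hB)
      (ENNReal.mul_ne_top ENNReal.ofReal_ne_top
        (ENNReal.mul_ne_top (ENNReal.natCast_ne_top _) hA))] at hreal
    simp only [ENNReal.toReal_mul, ENNReal.toReal_ofReal hε0, ENNReal.toReal_natCast,
      ENNReal.toReal_ofNat] at hreal
    rw [← mul_assoc, hεκ] at hreal
    have hexp : 1 - κ ≤ Real.exp (-κ) := by linarith [Real.add_one_le_exp (-κ)]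
    have hA' : A.toReal ≤ Real.exp (-κ * T) * (Fintype.card V * (disc Γ₀ : ℝ) ^ 2) :=
      ENNReal.toReal_le_of_le_ofReal (by positivity) ih
    refine (ENNReal.le_ofReal_iff_toReal_le hB (by positivity)).2 ?_
    calc B.toReal ≤ (1 - κ) * A.toReal := by linarith
      _ ≤ Real.exp (-κ) * (Real.exp (-κ * T) * (Fintype.card V * (disc Γ₀ : ℝ) ^ 2)) :=
        mul_le_mul hexp hA' ENNReal.toReal_nonneg (Real.exp_pos _).le
      _ = _ := by
        rw [← mul_assoc, ← Real.exp_add]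
        push_cast
        ring_nf

lemma ofReal_one_sub_le_measure_balanced {m : ℤ} {t : ℕ} {δ : ℝ}
    (h : ∫⁻ ω, (totalPot m (P.Γ t ω) : ENNReal) ∂P.μ ≤ ENNReal.ofReal δ) (hδ : 0 ≤ δ) :
    ENNReal.ofReal (1 - δ) ≤ P.μ {ω | ∀ v, |(P.Γ t ω v : ℤ) - m| ≤ 1} := by
  have hmeas : Measurable fun ω => (totalPot m (P.Γ t ω) : ENNReal) :=
    ((measurable_from_top (f := fun x : V → ℕ => (totalPot m x : ENNReal))).comp
      (P.meas_Γ t)).mono (P.hist_le t) le_rfl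
  have h1 := (mul_meas_ge_le_lintegral (μ := P.μ) hmeas 1).trans h
  rw [one_mul] at h1
  have h2 : {ω | 1 ≤ (totalPot m (P.Γ t ω) : ENNReal)}ᶜ ⊆
      {ω | ∀ v, |(P.Γ t ω v : ℤ) - m| ≤ 1} := fun ω hω v => by
    have h3 : ¬ (1 : ENNReal) ≤ (totalPot m (P.Γ t ω) : ENNReal) := hω
    exact abs_sub_le_one_of_totalPot_lt_one (by exact_mod_cast not_le.1 h3) v
  refine le_trans ?_ (measure_mono h2)
  rw [prob_compl_eq_one_sub (measurableSet_le measurable_const hmeas), ENNReal.ofReal_sub _ hδ,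
    ENNReal.ofReal_one]
  exact tsub_le_tsub_left h1 _

end EMLoadProcess

end

/-- **Balancing time for constant-fairness random matching algorithms (Theorem 1).**
Suppose `p ∈ (0,1]` and `q ∈ [0,1)` satisfy `max{p, 1−q} ≥ θ/n` for a constant `θ > 0`, and
consider a random matching algorithm on an edge-Markovian evolving graph with parameters
`p, q` whose matching distributions satisfy the `F`-fair condition for a constant
`0 < F ≤ 1`.  Then there is a constant `C > 0` such that for any initial configuration
`Γ₀`, with probability at least `1 − 1/n` the balancing time satisfies
`T_bal ≤ C·r·log(Δ·n)`, where `r = max{p/(1−q), (1−q)/p}`. -/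
theorem random_matching_balancing_time_whp (θ F : ℝ) (hθ : 0 < θ) (hF0 : 0 < F)
    (hF1 : F ≤ 1) :
    ∃ C : ℝ, 0 < C ∧
      ∀ (V : Type) [Fintype V] [DecidableEq V] [Nonempty V],
        ∀ (P : EMLoadProcess V) (Γ₀ : V → ℕ),
          P.Fair F →
          θ / (Fintype.card V : ℝ) ≤ max P.p (1 - P.q) →
          (∀ ω, P.Γ 0 ω = Γ₀) →
          ENNReal.ofReal (1 - 1 / (Fintype.card V : ℝ)) ≤
            P.μ {ω | ∃ t : ℕ,
              (t : ℝ) ≤ C * P.r * Real.log ((disc Γ₀ : ℝ) * (Fintype.card V : ℝ)) ∧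
              ∀ v : V, |(P.Γ t ω v : ℤ) - roundNear (avgLoad Γ₀)| ≤ 1} := by
  set c := F * θ / (16 * (1 + θ)) with hc
  have hc0 : 0 < c := by positivity
  refine ⟨2 / c + 4, by positivity, ?_⟩
  intro V _ _ _ P Γ₀ hF hpq h0
  have hr := P.one_le_r
  rcases Nat.eq_zero_or_pos (disc Γ₀) with hd | hd
  · have hpot : totalPot (roundNear (avgLoad Γ₀)) Γ₀ < 1 := by
      have := totalPot_le Γ₀
      rw [hd] at this
      simpa using this
    refine (P.ofReal_one_sub_le_measure_balanced (t := 0) (m := roundNear (avgLoad Γ₀)) ?_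
      (by positivity)).trans
      (MeasureTheory.measure_mono fun ω hω => ⟨0, by simp [hd], hω⟩)
    simp [h0, Nat.lt_one_iff.1 hpot]
  have hn0 : 0 < Fintype.card V := Fintype.card_pos
  rcases (Nat.succ_le_of_lt hn0).eq_or_lt with hn | hn
  · rw [← hn]
    simp
  set n : ℝ := (Fintype.card V : ℝ) with hn'
  have hn2 : 2 ≤ n := by rw [hn']; exact_mod_cast hn
  have hd1 : (1 : ℝ) ≤ disc Γ₀ := by exact_mod_cast hd
  set L := Real.log ((disc Γ₀ : ℝ) * n) with hL
  have hL2 : 1 / 2 ≤ L := by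
    have h1 : Real.log 2 ≤ L := Real.log_le_log (by norm_num) (by nlinarith)
    linarith [Real.log_two_gt_d9]
  set T := ⌈2 * L / (c / P.r)⌉₊ with hT
  have hκ0 : 0 < c / P.r := by positivity
  have hTle : ((T + 1 : ℕ) : ℝ) ≤ (2 / c + 4) * P.r * L := by
    have h1 := Nat.ceil_lt_add_one (a := 2 * L / (c / P.r)) (by positivity)
    have h2 : 2 * L / (c / P.r) = 2 / c * P.r * L := by field_simp
    have h3 : 1 / 2 ≤ P.r * L := by nlinarith
    push_cast
    rw [← hT] at h1
    nlinarith
  refine (P.ofReal_one_sub_le_measure_balanced (t := T + 1) (m := roundNear (avgLoad Γ₀)) ?_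
    (by positivity)).trans (MeasureTheory.measure_mono fun ω hω => ⟨T + 1, hTle, hω⟩)
  refine (hF.lintegral_totalPot_le hF0 hθ hpq h0 T).trans (ENNReal.ofReal_le_ofReal ?_)
  have hexp : Real.exp (-(c / P.r) * T) ≤ (((disc Γ₀ : ℝ) * n) ^ 2)⁻¹ := by
    have h1 : 2 * L ≤ c / P.r * T := by
      rw [mul_comm (c / P.r), ← div_le_iff₀ hκ0]
      exact Nat.le_ceil _
    calc Real.exp (-(c / P.r) * T) ≤ Real.exp (-(L + L)) := Real.exp_le_exp.2 (by linarith)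
      _ = _ := by
        rw [Real.exp_neg, Real.exp_add, hL, Real.exp_log (by positivity), ← sq]
  calc _ ≤ (((disc Γ₀ : ℝ) * n) ^ 2)⁻¹ * (n * (disc Γ₀ : ℝ) ^ 2) := by gcongr
    _ = 1 / n := by field_simp

end
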